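/- arXiv:1312.2786 — 3 statements merged into one kernel-verified Lean document; each statement's English description precedes it below -/
import Mathlib

section
/- For a three-form P on V = ℂ^6, the matrix K_P satisfies K_P² = 𝒟(P)·I, where 𝒟(P) = (1/6) Tr(K_P²) and I is the 6×6 identity matrix. -/
/-- The Levi-Civita symbol `ε^{i_1 ... i_6}` on six indices. -/
noncomputable def eps6 (f : Fin 6 → Fin 6) : ℂ :=
  if h : Function.Bijective f then ((Equiv.Perm.sign (Equiv.ofBijective f h) : ℤ) : ℂ) else 0

/-- Antisymmetry of the components of a three-form. -/
def Antisym3 (P : Fin 6 → Fin 6 → Fin 6 → ℂ) : Prop :=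
  (∀ i j k, P i j k = -P j i k) ∧ (∀ i j k, P i j k = -P i k j)

/-- The 6×6 matrix covariant `(K_P)^a_b = (1/12) ε^{a i_1 i_2 i_3 i_4 i_5} P_{b i_1 i_2} P_{i_3 i_4 i_5}`. -/
noncomputable def Kmat (P : Fin 6 → Fin 6 → Fin 6 → ℂ) : Matrix (Fin 6) (Fin 6) ℂ :=
  Matrix.of fun a b =>
    (1/12 : ℂ) * ∑ i1, ∑ i2, ∑ i3, ∑ i4, ∑ i5,
      eps6 ![a, i1, i2, i3, i4, i5] * P b i1 i2 * P i3 i4 i5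

/-- The quartic invariant `𝒟(P) = (1/6) Tr(K_P²)`. -/
noncomputable def Dinv (P : Fin 6 → Fin 6 → Fin 6 → ℂ) : ℂ :=
  (1/6 : ℂ) * Matrix.trace (Kmat P * Kmat P)

open Equiv in
lemma eps6_perm_comp (σ : Perm (Fin 6)) (f : Fin 6 → Fin 6) :
    eps6 (σ ∘ f) = ((Perm.sign σ : ℤ) : ℂ) * eps6 f := by
  unfold eps6
  by_cases h : Function.Bijective f
  · have h' : Function.Bijective (σ ∘ f) := σ.bijective.comp h
    have : Equiv.ofBijective (σ ∘ f) h' = σ * Equiv.ofBijective f h := by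
      ext i; simp
    rw [dif_pos h, dif_pos h', this]
    simp
  · have h' : ¬ Function.Bijective (σ ∘ f) :=
      fun hc => h ((Function.Bijective.of_comp_iff' σ.bijective f).1 hc)
    rw [dif_neg h, dif_neg h']
    simp

/-- The three-form with permuted indices. -/
def permForm (σ : Equiv.Perm (Fin 6)) (P : Fin 6 → Fin 6 → Fin 6 → ℂ) :
    Fin 6 → Fin 6 → Fin 6 → ℂ := fun i j k => P (σ i) (σ j) (σ k)

lemma permForm_antisym (σ : Equiv.Perm (Fin 6)) {P : Fin 6 → Fin 6 → Fin 6 → ℂ}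
    (hP : Antisym3 P) : Antisym3 (permForm σ P) :=
  ⟨fun _ _ _ => hP.1 _ _ _, fun _ _ _ => hP.2 _ _ _⟩

lemma Kmat_perm (σ : Equiv.Perm (Fin 6)) (P : Fin 6 → Fin 6 → Fin 6 → ℂ) (a b : Fin 6) :
    Kmat P (σ a) (σ b) = ((Equiv.Perm.sign σ : ℤ) : ℂ) * Kmat (permForm σ P) a b := by
  have key : ∀ i1 i2 i3 i4 i5, eps6 ![σ a, σ i1, σ i2, σ i3, σ i4, σ i5]
      = ((Equiv.Perm.sign σ : ℤ) : ℂ) * eps6 ![a, i1, i2, i3, i4, i5] := by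
    intro i1 i2 i3 i4 i5
    rw [← eps6_perm_comp]
    congr 1
    ext i
    fin_cases i <;> rfl
  unfold Kmat
  simp only [Matrix.of_apply]
  rw [mul_left_comm]
  congr 1
  rw [← Equiv.sum_comp σ, Finset.mul_sum]
  refine Finset.sum_congr rfl fun i1 _ => ?_
  rw [← Equiv.sum_comp σ, Finset.mul_sum]
  refine Finset.sum_congr rfl fun i2 _ => ?_
  rw [← Equiv.sum_comp σ, Finset.mul_sum]
  refine Finset.sum_congr rfl fun i3 _ => ?_
  rw [← Equiv.sum_comp σ, Finset.mul_sum]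
  refine Finset.sum_congr rfl fun i4 _ => ?_
  rw [← Equiv.sum_comp σ, Finset.mul_sum]
  refine Finset.sum_congr rfl fun i5 _ => ?_
  rw [key]
  unfold permForm
  ring

/-- Sign of the difference of two indices. -/
def sg (i j : Fin 6) : ℤ := if i < j then 1 else if i = j then 0 else -1

lemma eps6_eq (a b c d e f : Fin 6) : eps6 ![a, b, c, d, e, f] =
    ((sg a b * (sg a c * sg b c) * (sg a d * sg b d * sg c d) *
      (sg a e * sg b e * sg c e * sg d e) *
      (sg a f * sg b f * sg c f * sg d f * sg e f) : ℤ) : ℂ) := by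
  unfold eps6
  split_ifs with h
  · congr 1
    have hne : ∀ i j : Fin 6, i ≠ j → ![a, b, c, d, e, f] i ≠ ![a, b, c, d, e, f] j :=
      fun i j hij hc => hij (h.1 hc)
    have hs : ∀ x y : Fin 6, x ≠ y → sg x y = if x < y then 1 else -1 := by decide
    rw [hs a b (hne 0 1 (by decide)), hs a c (hne 0 2 (by decide)), hs a d (hne 0 3 (by decide)),
      hs a e (hne 0 4 (by decide)), hs a f (hne 0 5 (by decide)), hs b c (hne 1 2 (by decide)),
      hs b d (hne 1 3 (by decide)), hs b e (hne 1 4 (by decide)), hs b f (hne 1 5 (by decide)),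
      hs c d (hne 2 3 (by decide)), hs c e (hne 2 4 (by decide)), hs c f (hne 2 5 (by decide)),
      hs d e (hne 3 4 (by decide)), hs d f (hne 3 5 (by decide)), hs e f (hne 4 5 (by decide))]
    rw [Equiv.Perm.sign_eq_prod_prod_Iio]
    have h0 : Finset.Iio (0 : Fin 6) = ∅ := by decide
    have h1 : Finset.Iio (1 : Fin 6) = {0} := by decide
    have h2 : Finset.Iio (2 : Fin 6) = {0, 1} := by decide
    have h3 : Finset.Iio (3 : Fin 6) = {0, 1, 2} := by decide
    have h4 : Finset.Iio (4 : Fin 6) = {0, 1, 2, 3} := by decide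
    have h5 : Finset.Iio (5 : Fin 6) = {0, 1, 2, 3, 4} := by decide
    rw [Fin.prod_univ_six, h0, h1, h2, h3, h4, h5]
    have e (u v : Fin 6) : (((if u < v then 1 else -1 : ℤˣ)) : ℤ) = if u < v then 1 else -1 := by
      split_ifs <;> rfl
    rw [Finset.prod_empty, Finset.prod_singleton, Finset.prod_pair (by decide),
      Finset.prod_insert (by decide), Finset.prod_pair (by decide),
      Finset.prod_insert (by decide), Finset.prod_insert (by decide),
      Finset.prod_pair (by decide),
      Finset.prod_insert (by decide), Finset.prod_insert (by decide),
      Finset.prod_insert (by decide), Finset.prod_pair (by decide)]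
    simp only [Units.val_mul, Units.val_one, one_mul, e, mul_assoc]
    rfl
  · have hinj : ¬ Function.Injective ![a, b, c, d, e, f] :=
      fun hi => h (Finite.injective_iff_bijective.1 hi)
    have hz : ∀ x : Fin 6, sg x x = 0 := by decide
    symm
    rw [Int.cast_eq_zero]
    by_contra hc
    apply hinj
    have hne : ∀ x y : Fin 6, sg x y ≠ 0 → x ≠ y := by
      rintro x y hxy rfl
      exact hxy (hz x)
    simp only [mul_eq_zero, not_or] at hc
    intro i j hij
    fin_cases i <;> fin_cases j <;> simp at hij ⊢ <;> subst hij <;> simp [hz] at hc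

lemma form_simps {P : Fin 6 → Fin 6 → Fin 6 → ℂ} (hP : Antisym3 P) :
    (∀ i j, P i i j = 0) ∧ (∀ i j, P i j j = 0) ∧ (∀ i j, P i j i = 0) ∧
    (∀ i j k, j < i → P i j k = - P j i k) ∧ (∀ i j k, k < j → P i j k = - P i k j) := by
  have A : ∀ i j, P i i j = 0 := fun i j => self_eq_neg.1 (hP.1 i i j)
  have B : ∀ i j, P i j j = 0 := fun i j => self_eq_neg.1 (hP.2 i j j)
  refine ⟨A, B, ?_, fun i j k _ => hP.1 i j k, fun i j k _ => hP.2 i j k⟩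
  intro i j
  rw [hP.2, A, neg_zero]

set_option maxHeartbeats 4000000 in
lemma Kmat_zero {P : Fin 6 → Fin 6 → Fin 6 → ℂ} (hP : Antisym3 P) (b : Fin 6) :
    Kmat P 0 b = P b 1 2 * P 3 4 5
    - P b 1 3 * P 2 4 5
    + P b 1 4 * P 2 3 5
    - P b 1 5 * P 2 3 4
    + P b 2 3 * P 1 4 5
    - P b 2 4 * P 1 3 5
    + P b 2 5 * P 1 3 4
    + P b 3 4 * P 1 2 5
    - P b 3 5 * P 1 2 4
    + P b 4 5 * P 1 2 3 := by
  obtain ⟨A, B, C, D, E⟩ := form_simps hP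
  -- inner sum over the last three indices
  have inner : ∀ i1 i2 : Fin 6, ∑ i3, ∑ i4, ∑ i5, eps6 ![0, i1, i2, i3, i4, i5] * P b i1 i2 *
      P i3 i4 i5 = ((sg 0 i1 * (sg 0 i2 * sg i1 i2) : ℤ) : ℂ) * P b i1 i2 *
        ∑ i3, ((sg 0 i3 * sg i1 i3 * sg i2 i3 : ℤ) : ℂ) *
        ∑ i4, ((sg 0 i4 * sg i1 i4 * sg i2 i4 * sg i3 i4 : ℤ) : ℂ) *
        ∑ i5, ((sg 0 i5 * sg i1 i5 * sg i2 i5 * sg i3 i5 * sg i4 i5 : ℤ) : ℂ) * P i3 i4 i5 := by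
    intro i1 i2
    simp only [Finset.mul_sum]
    refine Finset.sum_congr rfl fun i3 _ => Finset.sum_congr rfl fun i4 _ =>
      Finset.sum_congr rfl fun i5 _ => ?_
    rw [eps6_eq]
    push_cast
    ring
  unfold Kmat
  simp only [Matrix.of_apply, inner]
  simp [↓Fin.sum_univ_six, sg, B, A, C]
  simp [D, E]
  ring

lemma Kmat_row {P : Fin 6 → Fin 6 → Fin 6 → ℂ} (a b : Fin 6) (ha : a ≠ 0) :
    Kmat P a b = - Kmat (permForm (Equiv.swap 0 a) P) 0 (Equiv.swap 0 a b) := by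
  have := Kmat_perm (Equiv.swap 0 a) P 0 (Equiv.swap 0 a b)
  simpa [Equiv.Perm.sign_swap ha.symm] using this

set_option maxHeartbeats 4000000 in
lemma Kmat_sq_base {P : Fin 6 → Fin 6 → Fin 6 → ℂ} (hP : Antisym3 P) :
    (Kmat P * Kmat P) 0 1 = 0 ∧ (Kmat P * Kmat P) 0 0 = (Kmat P * Kmat P) 1 1 := by
  obtain ⟨A, B, C, D, E⟩ := form_simps hP
  have hrow : ∀ a b : Fin 6, a ≠ 0 → Kmat P a b = _ := fun a b ha =>
    (Kmat_row a b ha).trans (congrArg Neg.neg (Kmat_zero (permForm_antisym _ hP) _))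
  simp only [Matrix.mul_apply, Fin.sum_univ_six]
  rw [Kmat_zero hP 0, Kmat_zero hP 1, Kmat_zero hP 2, Kmat_zero hP 3, Kmat_zero hP 4,
    Kmat_zero hP 5, hrow 1 0 (by decide), hrow 1 1 (by decide), hrow 1 2 (by decide),
    hrow 1 3 (by decide), hrow 1 4 (by decide), hrow 1 5 (by decide),
    hrow 2 1 (by decide), hrow 3 1 (by decide), hrow 4 1 (by decide), hrow 5 1 (by decide),
    hrow 2 0 (by decide), hrow 3 0 (by decide), hrow 4 0 (by decide), hrow 5 0 (by decide)]
  simp [permForm, Equiv.swap_apply_def, A, B, C]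
  simp [D, E]
  constructor <;> ring

lemma Kmat_sq_perm (σ : Equiv.Perm (Fin 6)) (P : Fin 6 → Fin 6 → Fin 6 → ℂ) (a b : Fin 6) :
    (Kmat P * Kmat P) (σ a) (σ b) = (Kmat (permForm σ P) * Kmat (permForm σ P)) a b := by
  simp only [Matrix.mul_apply]
  rw [← Equiv.sum_comp σ]
  refine Finset.sum_congr rfl fun c _ => ?_
  rw [Kmat_perm, Kmat_perm]
  rcases Int.units_eq_one_or (Equiv.Perm.sign σ) with h | h <;> simp [h]

lemma Kmat_sq_ne {P : Fin 6 → Fin 6 → Fin 6 → ℂ} (hP : Antisym3 P) (a b : Fin 6) (hab : a ≠ b) :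
    (Kmat P * Kmat P) a b = 0 ∧ (Kmat P * Kmat P) a a = (Kmat P * Kmat P) b b := by
  obtain ⟨σ, rfl, rfl⟩ : ∃ σ : Equiv.Perm (Fin 6), σ 0 = a ∧ σ 1 = b := by
    refine ⟨Equiv.swap (Equiv.swap 0 a 1) b * Equiv.swap 0 a, ?_, ?_⟩
    · revert a b; decide
    · simp
  rw [Kmat_sq_perm, Kmat_sq_perm, Kmat_sq_perm]
  exact Kmat_sq_base (permForm_antisym σ hP)

/-- for a three-form `P` on `V = ℂ^6`, `K_P² = 𝒟(P)·I` with
`𝒟(P) = (1/6) Tr(K_P²)`. -/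
theorem Kmat_sq_eq_Dinv_smul_one (P : Fin 6 → Fin 6 → Fin 6 → ℂ) (hP : Antisym3 P) :
    Kmat P * Kmat P = Dinv P • (1 : Matrix (Fin 6) (Fin 6) ℂ) := by
  ext a b
  by_cases hab : a = b
  · subst hab
    have h : ∀ c, (Kmat P * Kmat P) c c = (Kmat P * Kmat P) a a := by
      intro c
      by_cases hc : c = a
      · rw [hc]
      · exact (Kmat_sq_ne hP c a hc).2
    simp only [Dinv, Matrix.trace, Matrix.diag_apply, h, Matrix.smul_apply, Matrix.one_apply_eq]
    simp
  · rw [(Kmat_sq_ne hP a b hab).1]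
    simp [hab]
end

section
/- For P ∈ ∧³(ℂ^6)* with 𝒟(P) ≠ 0, the Freudenthal dual P̂ := -i P̃/√𝒟(P) satisfies 𝒟(P̂) = 𝒟(P) and (P̂)^ = -P. -/
/-- The dual three-form `P̃` with components `P̃_{abc} = P_{bcd} (K_P)^d_a`. -/
noncomputable def Ptilde (P : Fin 6 → Fin 6 → Fin 6 → ℂ) : Fin 6 → Fin 6 → Fin 6 → ℂ :=
  fun a b c => ∑ d, P b c d * Kmat P d a

/-- The Freudenthal dual `P̂ = -i P̃ / √𝒟(P)`, where `s` is the fixed branch of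
the square root of `𝒟(P)`. -/
noncomputable def Phat (s : ℂ) (P : Fin 6 → Fin 6 → Fin 6 → ℂ) :
    Fin 6 → Fin 6 → Fin 6 → ℂ :=
  fun i j k => -Complex.I * Ptilde P i j k / s

open Matrix

namespace FD

abbrev T3 := Fin 6 → Fin 6 → Fin 6 → ℂ

/-- sign of an ordered pair -/
def sg (a b : Fin 6) : ℂ := if a < b then 1 else if b < a then -1 else 0

lemma sg_self (a : Fin 6) : sg a a = 0 := by simp [sg]

lemma sg_lt {a b : Fin 6} (h : a < b) : sg a b = 1 := by simp [sg, h]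

lemma sg_gt {a b : Fin 6} (h : b < a) : sg a b = -1 := by simp [sg, h, not_lt.mpr h.le]

lemma sg_swap (a b : Fin 6) : sg a b = - sg b a := by
  rcases lt_trichotomy a b with h | h | h
  · rw [sg_lt h, sg_gt h]; simp
  · subst h; simp [sg_self]
  · rw [sg_lt h, sg_gt h]

/-- explicit form of the Levi-Civita symbol -/
def ee (a b c i j k : Fin 6) : ℂ :=
  sg a b * sg a c * sg a i * sg a j * sg a k *
  (sg b c * sg b i * sg b j * sg b k) *
  (sg c i * sg c j * sg c k) * (sg i j * sg i k) * sg j k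

lemma eps_prod (f : Fin 6 → Fin 6) :
    eps6 f = ∏ i, ∏ j ∈ Finset.Ioi i, sg (f i) (f j) := by
  unfold eps6
  split_ifs with h
  · rw [Equiv.Perm.sign_eq_prod_prod_Ioi]
    push_cast
    refine Finset.prod_congr rfl fun i _ => Finset.prod_congr rfl fun j hj => ?_
    have hij : i < j := by simpa using hj
    have hne : f i ≠ f j := fun e => hij.ne (h.1 e)
    rcases lt_or_gt_of_ne hne with h1 | h1
    · simp [sg_lt h1, h1]
    · simp [sg_gt h1, not_lt.mpr h1.le]
  · have : ¬ Function.Injective f := fun hi => h (Finite.injective_iff_bijective.mp hi)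
    simp only [Function.Injective, not_forall] at this
    obtain ⟨i, j, hf, hne⟩ := this
    symm
    rcases lt_or_gt_of_ne hne with h1 | h1
    · refine Finset.prod_eq_zero (Finset.mem_univ i) (Finset.prod_eq_zero (i := j) (by simpa using h1) ?_)
      rw [hf, sg_self]
    · refine Finset.prod_eq_zero (Finset.mem_univ j) (Finset.prod_eq_zero (i := i) (by simpa using h1) ?_)
      rw [hf, sg_self]

lemma eps_ee (a b c i j k : Fin 6) : eps6 ![a, b, c, i, j, k] = ee a b c i j k := by
  rw [eps_prod]
  have h0 : Finset.Ioi (0 : Fin 6) = {1,2,3,4,5} := by decide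
  have h1 : Finset.Ioi (1 : Fin 6) = {2,3,4,5} := by decide
  have h2 : Finset.Ioi (2 : Fin 6) = {3,4,5} := by decide
  have h3 : Finset.Ioi (3 : Fin 6) = {4,5} := by decide
  have h4 : Finset.Ioi (4 : Fin 6) = {5} := by decide
  have h5 : Finset.Ioi (5 : Fin 6) = ∅ := by decide
  rw [Fin.prod_univ_six, h0, h1, h2, h3, h4, h5]
  simp [ee, -mul_eq_mul_left_iff, -mul_eq_mul_right_iff]
  ring

noncomputable def star (P : T3) : T3 := fun a b c =>
  (1/6 : ℂ) * ∑ i, ∑ j, ∑ k, ee a b c i j k * P i j k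

noncomputable def KB (P R : T3) : Matrix (Fin 6) (Fin 6) ℂ := fun a b =>
  (1/2 : ℂ) * ∑ i, ∑ j, star R a i j * P b i j

lemma Kmat_eq (P : T3) : Kmat P = KB P P := by
  ext a b
  simp only [Kmat, KB, star, Matrix.of_apply, eps_ee, Finset.mul_sum, Finset.sum_mul]
  refine Finset.sum_congr rfl fun i _ => Finset.sum_congr rfl fun j _ =>
    Finset.sum_congr rfl fun k _ => Finset.sum_congr rfl fun l _ =>
    Finset.sum_congr rfl fun m _ => ?_
  ring

lemma anti_zero1 {P : T3} (h : Antisym3 P) (i k : Fin 6) : P i i k = 0 := by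
  have := h.1 i i k
  exact self_eq_neg.mp this

lemma anti_zero2 {P : T3} (h : Antisym3 P) (i k : Fin 6) : P i k k = 0 := by
  have := h.2 i k k
  exact self_eq_neg.mp this

lemma anti_s1 {P : T3} (h : Antisym3 P) (i j k : Fin 6) (_ : j < i) : P i j k = - P j i k :=
  h.1 i j k

lemma anti_s2 {P : T3} (h : Antisym3 P) (i j k : Fin 6) (_ : k < j) : P i j k = - P i k j :=
  h.2 i j k

lemma anti_ext {P R : T3} (hP : Antisym3 P) (hR : Antisym3 R)
    (h : ∀ i j k, i < j → j < k → P i j k = R i j k) : P = R := by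
  have key : ∀ i j k, i < j → P i j k = R i j k := by
    intro i j k hij
    rcases lt_trichotomy j k with h1 | h1 | h1
    · exact h i j k hij h1
    · subst h1; rw [anti_zero2 hP, anti_zero2 hR]
    · rcases lt_trichotomy i k with h2 | h2 | h2
      · rw [hP.2, hR.2, h i k j h2 h1]
      · subst h2; rw [hP.2, hR.2, anti_zero1 hP, anti_zero1 hR]
      · rw [hP.2, hR.2, hP.1, hR.1, h k i j h2 hij]
  funext i j k
  rcases lt_trichotomy i j with h1 | h1 | h1
  · exact key i j k h1
  · subst h1; rw [anti_zero1 hP, anti_zero1 hR]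
  · rw [hP.1, hR.1, key j i k h1]

lemma ee_s1 (a b c i j k : Fin 6) : ee a b c i j k = - ee b a c i j k := by
  unfold ee; rw [sg_swap a b]; ring

lemma ee_s2 (a b c i j k : Fin 6) : ee a b c i j k = - ee a c b i j k := by
  unfold ee; rw [sg_swap b c]; ring

lemma ee_s4 (a b c i j k : Fin 6) : ee a b c i j k = - ee a b c j i k := by
  unfold ee; rw [sg_swap i j]; ring

lemma ee_s5 (a b c i j k : Fin 6) : ee a b c i j k = - ee a b c i k j := by
  unfold ee; rw [sg_swap j k]; ring

lemma star_anti (P : T3) : Antisym3 (star P) := by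
  constructor <;> intro a b c <;> unfold star
  · simp only [ee_s1 a b c, neg_mul, Finset.sum_neg_distrib, mul_neg]
  · simp only [ee_s2 a b c, neg_mul, Finset.sum_neg_distrib, mul_neg]

/-- sum of a product of antisymmetric pairs -/
lemma sum2 (F : Fin 6 → Fin 6 → ℂ) (hs : ∀ i j, F i j = F j i) (h0 : ∀ i, F i i = 0) :
    ∑ i, ∑ j, F i j = 2 * (F 0 1 + F 0 2 + F 0 3 + F 0 4 + F 0 5 + F 1 2 + F 1 3 + F 1 4
      + F 1 5 + F 2 3 + F 2 4 + F 2 5 + F 3 4 + F 3 5 + F 4 5) := by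
  simp only [Fin.sum_univ_six, h0]
  rw [hs 1 0, hs 2 0, hs 3 0, hs 4 0, hs 5 0, hs 2 1, hs 3 1, hs 4 1, hs 5 1, hs 3 2, hs 4 2,
    hs 5 2, hs 4 3, hs 5 3, hs 5 4]
  ring

lemma sum3 (F : T3) (h1 : ∀ i j k, F i j k = F j i k) (h2 : ∀ i j k, F i j k = F i k j)
    (h0 : ∀ i k, F i k k = 0) :
    ∑ i, ∑ j, ∑ k, F i j k = 6 * (F 0 1 2 + F 0 1 3 + F 0 1 4 + F 0 1 5 + F 0 2 3 + F 0 2 4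
      + F 0 2 5 + F 0 3 4 + F 0 3 5 + F 0 4 5 + F 1 2 3 + F 1 2 4 + F 1 2 5 + F 1 3 4 + F 1 3 5
      + F 1 4 5 + F 2 3 4 + F 2 3 5 + F 2 4 5 + F 3 4 5) := by
  have s1 : ∀ i j k, j < i → F i j k = F j i k := fun i j k _ => h1 i j k
  have s2 : ∀ i j k, k < j → F i j k = F i k j := fun i j k _ => h2 i j k
  have z : ∀ i k, F i i k = 0 := fun i k => by rw [h2, h1, h0]
  simp only [sum2 _ (h2 _) (h0 _)]
  simp (discharger := decide) only [Fin.sum_univ_six, s1, s2, z, h0]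
  ring

lemma star_eval {P : T3} (h : Antisym3 P) (a b c : Fin 6) : star P a b c =
    (ee a b c 0 1 2 * P 0 1 2 + ee a b c 0 1 3 * P 0 1 3 + ee a b c 0 1 4 * P 0 1 4
    + ee a b c 0 1 5 * P 0 1 5 + ee a b c 0 2 3 * P 0 2 3 + ee a b c 0 2 4 * P 0 2 4
    + ee a b c 0 2 5 * P 0 2 5 + ee a b c 0 3 4 * P 0 3 4 + ee a b c 0 3 5 * P 0 3 5
    + ee a b c 0 4 5 * P 0 4 5 + ee a b c 1 2 3 * P 1 2 3 + ee a b c 1 2 4 * P 1 2 4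
    + ee a b c 1 2 5 * P 1 2 5 + ee a b c 1 3 4 * P 1 3 4 + ee a b c 1 3 5 * P 1 3 5
    + ee a b c 1 4 5 * P 1 4 5 + ee a b c 2 3 4 * P 2 3 4 + ee a b c 2 3 5 * P 2 3 5
    + ee a b c 2 4 5 * P 2 4 5 + ee a b c 3 4 5 * P 3 4 5) := by
  unfold star
  rw [sum3 (fun i j k => ee a b c i j k * P i j k)]
  · ring
  · intro i j k; rw [ee_s4, h.1]; ring
  · intro i j k; rw [ee_s5, h.2]; ring
  · intro i k; rw [anti_zero2 h, mul_zero]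

/-- the twenty independent components of the dual trivector -/
lemma star_vals {P : T3} (h : Antisym3 P) :
    (star P 0 1 2 = P 3 4 5 ∧ star P 0 1 3 = -P 2 4 5 ∧ star P 0 1 4 = P 2 3 5 ∧
     star P 0 1 5 = -P 2 3 4 ∧ star P 0 2 3 = P 1 4 5 ∧ star P 0 2 4 = -P 1 3 5 ∧
     star P 0 2 5 = P 1 3 4 ∧ star P 0 3 4 = P 1 2 5 ∧ star P 0 3 5 = -P 1 2 4 ∧
     star P 0 4 5 = P 1 2 3) ∧
    (star P 1 2 3 = -P 0 4 5 ∧ star P 1 2 4 = P 0 3 5 ∧ star P 1 2 5 = -P 0 3 4 ∧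
     star P 1 3 4 = -P 0 2 5 ∧ star P 1 3 5 = P 0 2 4 ∧ star P 1 4 5 = -P 0 2 3 ∧
     star P 2 3 4 = P 0 1 5 ∧ star P 2 3 5 = -P 0 1 4 ∧ star P 2 4 5 = P 0 1 3 ∧
     star P 3 4 5 = -P 0 1 2) := by
  refine ⟨⟨?_, ?_, ?_, ?_, ?_, ?_, ?_, ?_, ?_, ?_⟩, ?_, ?_, ?_, ?_, ?_, ?_, ?_, ?_, ?_, ?_⟩ <;>
  · rw [star_eval h]
    simp [ee, sg]

lemma KB_eval {P R : T3} (h : Antisym3 P) (a b : Fin 6) : KB P R a b =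
    star R a 0 1 * P b 0 1 + star R a 0 2 * P b 0 2 + star R a 0 3 * P b 0 3
    + star R a 0 4 * P b 0 4 + star R a 0 5 * P b 0 5 + star R a 1 2 * P b 1 2
    + star R a 1 3 * P b 1 3 + star R a 1 4 * P b 1 4 + star R a 1 5 * P b 1 5
    + star R a 2 3 * P b 2 3 + star R a 2 4 * P b 2 4 + star R a 2 5 * P b 2 5
    + star R a 3 4 * P b 3 4 + star R a 3 5 * P b 3 5 + star R a 4 5 * P b 4 5 := by
  unfold KB
  rw [sum2 (fun i j => star R a i j * P b i j)]
  · ring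
  · intro i j; rw [(star_anti R).2, h.2]; ring
  · intro i; rw [anti_zero2 h, mul_zero]


noncomputable def act (X : Matrix (Fin 6) (Fin 6) ℂ) (P : T3) : T3 := fun i j k =>
  ∑ d, (X d i * P d j k + X d j * P i d k + X d k * P i j d)

/-- contragredient action -/
noncomputable def cact (X : Matrix (Fin 6) (Fin 6) ℂ) (P : T3) : T3 := fun i j k =>
  ∑ d, (X i d * P d j k + X j d * P i d k + X k d * P i j d)

lemma act_anti (X : Matrix (Fin 6) (Fin 6) ℂ) {P : T3} (h : Antisym3 P) : Antisym3 (act X P) := by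
  constructor <;> intro i j k <;> unfold act <;> rw [← Finset.sum_neg_distrib] <;>
    refine Finset.sum_congr rfl fun d _ => ?_
  · rw [h.1 d j k, h.1 i d k, h.1 i j d]; ring
  · rw [h.2 d j k, h.2 i d k, h.2 i j d]; ring

lemma cact_anti (X : Matrix (Fin 6) (Fin 6) ℂ) {P : T3} (h : Antisym3 P) :
    Antisym3 (cact X P) := act_anti Xᵀ h

lemma triple_cases {p : Fin 6 → Fin 6 → Fin 6 → Prop}
    (h : (p 0 1 2 ∧ p 0 1 3 ∧ p 0 1 4 ∧ p 0 1 5 ∧ p 0 2 3 ∧ p 0 2 4 ∧ p 0 2 5 ∧ p 0 3 4 ∧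
      p 0 3 5 ∧ p 0 4 5) ∧ (p 1 2 3 ∧ p 1 2 4 ∧ p 1 2 5 ∧ p 1 3 4 ∧ p 1 3 5 ∧ p 1 4 5 ∧
      p 2 3 4 ∧ p 2 3 5 ∧ p 2 4 5 ∧ p 3 4 5)) :
    ∀ i j k, i < j → j < k → p i j k := by
  intro i j k hij hjk
  fin_cases i <;> fin_cases j <;> first | (exact absurd hij (by decide)) | skip
  all_goals fin_cases k <;> first | (exact absurd hjk (by decide)) | skip
  all_goals simp only [Fin.zero_eta, Fin.mk_one, Fin.reduceFinMk]
  all_goals tauto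

lemma star_act (X : Matrix (Fin 6) (Fin 6) ℂ) (hX : X.trace = 0) {P : T3} (h : Antisym3 P) :
    star (act X P) = fun a b c => - cact X (star P) a b c := by
  have hc := cact_anti X (star_anti P)
  have hx : X 5 5 = -(X 0 0 + X 1 1 + X 2 2 + X 3 3 + X 4 4) := by
    simp only [Matrix.trace, Fin.sum_univ_six, Matrix.diag_apply] at hX
    linear_combination hX
  refine anti_ext (star_anti _) ⟨?_, ?_⟩ (triple_cases ?_)
  · intro i j k; exact congrArg Neg.neg (hc.1 i j k)
  · intro i j k; exact congrArg Neg.neg (hc.2 i j k)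
  · have hs := star_anti P
    obtain ⟨⟨e1, e2, e3, e4, e5, e6, e7, e8, e9, e10⟩, f1, f2, f3, f4, f5, f6, f7, f8, f9, f10⟩ :=
      star_vals (act_anti X h)
    rw [e1, e2, e3, e4, e5, e6, e7, e8, e9, e10, f1, f2, f3, f4, f5, f6, f7, f8, f9, f10]
    clear e1 e2 e3 e4 e5 e6 e7 e8 e9 e10 f1 f2 f3 f4 f5 f6 f7 f8 f9 f10
    obtain ⟨⟨e1, e2, e3, e4, e5, e6, e7, e8, e9, e10⟩, f1, f2, f3, f4, f5, f6, f7, f8, f9, f10⟩ :=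
      star_vals h
    refine ⟨⟨?_, ?_, ?_, ?_, ?_, ?_, ?_, ?_, ?_, ?_⟩, ?_, ?_, ?_, ?_, ?_, ?_, ?_, ?_, ?_, ?_⟩ <;>
    · simp (discharger := decide) only [act, cact, Fin.sum_univ_six, anti_s1 h, anti_s2 h,
        anti_zero1 h, anti_zero2 h, anti_s1 hs, anti_s2 hs, anti_zero1 hs, anti_zero2 hs,
        e1, e2, e3, e4, e5, e6, e7, e8, e9, e10, f1, f2, f3, f4, f5, f6, f7, f8, f9, f10, hx]
      ring

/-- antisymmetric part of `KB` is scalar -/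
lemma KB_sub {P R : T3} (h : Antisym3 P) (h' : Antisym3 R) :
    ∃ c : ℂ, KB P R - KB R P = c • (1 : Matrix (Fin 6) (Fin 6) ℂ) := by
  refine ⟨KB P R 0 0 - KB R P 0 0, ?_⟩
  have hs := star_anti P
  have hs' := star_anti R
  obtain ⟨⟨e1, e2, e3, e4, e5, e6, e7, e8, e9, e10⟩, f1, f2, f3, f4, f5, f6, f7, f8, f9, f10⟩ :=
    star_vals h
  obtain ⟨⟨g1, g2, g3, g4, g5, g6, g7, g8, g9, g10⟩, k1, k2, k3, k4, k5, k6, k7, k8, k9, k10⟩ :=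
    star_vals h'
  ext a b
  rw [Matrix.sub_apply, Matrix.smul_apply]
  simp only [KB_eval h, KB_eval h']
  fin_cases a <;> fin_cases b <;>
  · simp (discharger := decide) only [Fin.zero_eta, Fin.mk_one, Fin.reduceFinMk,
        Matrix.one_apply_eq, Matrix.one_apply_ne, smul_eq_mul, anti_s1 h, anti_s2 h,
        anti_zero1 h, anti_zero2 h, anti_s1 hs, anti_s2 hs, anti_zero1 hs, anti_zero2 hs,
        anti_s1 h', anti_s2 h', anti_zero1 h', anti_zero2 h', anti_s1 hs', anti_s2 hs',
        anti_zero1 hs', anti_zero2 hs',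
        e1, e2, e3, e4, e5, e6, e7, e8, e9, e10, f1, f2, f3, f4, f5, f6, f7, f8, f9, f10,
        g1, g2, g3, g4, g5, g6, g7, g8, g9, g10, k1, k2, k3, k4, k5, k6, k7, k8, k9, k10]
    ring

lemma KB_trace {P : T3} (h : Antisym3 P) : (KB P P).trace = 0 := by
  have hs := star_anti P
  obtain ⟨⟨e1, e2, e3, e4, e5, e6, e7, e8, e9, e10⟩, f1, f2, f3, f4, f5, f6, f7, f8, f9, f10⟩ :=
    star_vals h
  simp only [Matrix.trace, Fin.sum_univ_six, Matrix.diag_apply, KB_eval h]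
  simp (discharger := decide) only [anti_s1 h, anti_s2 h,
        anti_zero1 h, anti_zero2 h, anti_s1 hs, anti_s2 hs, anti_zero1 hs, anti_zero2 hs,
        e1, e2, e3, e4, e5, e6, e7, e8, e9, e10, f1, f2, f3, f4, f5, f6, f7, f8, f9, f10]
  ring

set_option maxHeartbeats 8000000 in
/-- the cubic covariant is antisymmetric -/
lemma cubic_le {P : T3} (h : Antisym3 P) (a b c : Fin 6) (hab : a ≤ b) :
    ∑ d, P b c d * KB P P d a = - ∑ d, P a c d * KB P P d b := by
  have hs := star_anti P
  obtain ⟨⟨e1, e2, e3, e4, e5, e6, e7, e8, e9, e10⟩, f1, f2, f3, f4, f5, f6, f7, f8, f9, f10⟩ :=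
    star_vals h
  simp only [KB_eval h, Fin.sum_univ_six]
  simp (discharger := decide) only [anti_s1 hs, anti_s2 hs, anti_zero1 hs, anti_zero2 hs,
        e1, e2, e3, e4, e5, e6, e7, e8, e9, e10, f1, f2, f3, f4, f5, f6, f7, f8, f9, f10]
  fin_cases a <;> fin_cases b <;> first | (exact absurd hab (by decide)) | skip
  all_goals
    clear hab
    simp (discharger := decide) only [Fin.zero_eta, Fin.mk_one, Fin.reduceFinMk, anti_s1 h,
        anti_s2 h, anti_zero1 h, anti_zero2 h, mul_zero, add_zero, zero_add, neg_zero, mul_neg,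
        neg_mul, neg_neg]
    fin_cases c
  all_goals
    try simp (discharger := decide) only [Fin.zero_eta, Fin.mk_one, Fin.reduceFinMk, anti_s1 h,
        anti_s2 h, anti_zero1 h, anti_zero2 h,
        mul_zero, zero_mul, add_zero, zero_add, neg_zero]
    try ring

lemma cubic {P : T3} (h : Antisym3 P) (a b c : Fin 6) :
    ∑ d, P b c d * KB P P d a = - ∑ d, P a c d * KB P P d b := by
  rcases le_total a b with hab | hab
  · exact cubic_le h a b c hab
  · rw [cubic_le h b a c hab, neg_neg]

lemma equivar (X : Matrix (Fin 6) (Fin 6) ℂ) (hX : X.trace = 0) {P R : T3}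
    (h' : Antisym3 R) :
    KB (act X P) R + KB P (act X R) = KB P R * X - X * KB P R := by
  ext a b
  have hs := star_anti R
  rw [Matrix.add_apply, Matrix.sub_apply, Matrix.mul_apply, Matrix.mul_apply]
  unfold KB
  rw [star_act X hX h']
  simp only [act, cact]
  generalize star R = Q at hs ⊢
  have e1 : ∑ i, ∑ j, Q a i j * ∑ d, (X d b * P d i j + X d i * P b d j + X d j * P b i d)
      = ∑ d, (∑ i, ∑ j, Q a i j * P d i j) * X d b
      + ∑ i, ∑ j, ∑ d, Q a i j * X d i * P b d j + ∑ i, ∑ j, ∑ d, Q a i j * X d j * P b i d := by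
    have : ∑ d, (∑ i, ∑ j, Q a i j * P d i j) * X d b
        = ∑ i, ∑ j, ∑ d, Q a i j * P d i j * X d b := by
      simp only [Finset.sum_mul]
      rw [Finset.sum_comm]
      exact Finset.sum_congr rfl fun i _ => Finset.sum_comm
    rw [this]
    simp only [Finset.mul_sum, ← Finset.sum_add_distrib]
    refine Finset.sum_congr rfl fun i _ => Finset.sum_congr rfl fun j _ =>
      Finset.sum_congr rfl fun k _ => ?_
    ring
  have e2 : ∑ i, ∑ j, (-∑ d, (X a d * Q d i j + X i d * Q a d j + X j d * Q a i d)) * P b i j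
      = - ∑ d, X a d * (∑ i, ∑ j, Q d i j * P b i j)
      - ∑ i, ∑ j, ∑ d, Q a d j * X i d * P b i j - ∑ i, ∑ j, ∑ d, Q a i d * X j d * P b i j := by
    have : ∑ d, X a d * (∑ i, ∑ j, Q d i j * P b i j)
        = ∑ i, ∑ j, ∑ d, X a d * (Q d i j * P b i j) := by
      simp only [Finset.mul_sum]
      rw [Finset.sum_comm]
      exact Finset.sum_congr rfl fun i _ => Finset.sum_comm
    rw [this]
    simp only [Finset.sum_mul, neg_mul, ← Finset.sum_neg_distrib, ← Finset.sum_sub_distrib]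
    refine Finset.sum_congr rfl fun i _ => Finset.sum_congr rfl fun j _ =>
      Finset.sum_congr rfl fun k _ => ?_
    ring
  have e3 : ∑ i, ∑ j, ∑ d, Q a i j * X d i * P b d j
      = ∑ i, ∑ j, ∑ d, Q a d j * X i d * P b i j := by
    rw [Finset.sum_comm]
    rw [Finset.sum_comm (f := fun i j => ∑ d, Q a d j * X i d * P b i j)]
    exact Finset.sum_congr rfl fun i _ => Finset.sum_comm
  have e4 : ∑ i, ∑ j, ∑ d, Q a i j * X d j * P b i d
      = ∑ i, ∑ j, ∑ d, Q a i d * X j d * P b i j :=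
    Finset.sum_congr rfl fun i _ => Finset.sum_comm
  have e5 : ∑ d, (1/2 : ℂ) * (∑ i, ∑ j, Q a i j * P d i j) * X d b
      = 1/2 * ∑ d, (∑ i, ∑ j, Q a i j * P d i j) * X d b := by
    rw [Finset.mul_sum]; exact Finset.sum_congr rfl fun d _ => by ring
  have e6 : ∑ d, X a d * ((1/2 : ℂ) * (∑ i, ∑ j, Q d i j * P b i j))
      = 1/2 * ∑ d, X a d * (∑ i, ∑ j, Q d i j * P b i j) := by
    rw [Finset.mul_sum]; exact Finset.sum_congr rfl fun d _ => by ring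
  rw [e1, e2, e3, e4, e5, e6]
  ring

lemma star_smul (c : ℂ) (P : T3) : star (c • P) = c • star P := by
  funext a b d
  simp only [star, Pi.smul_apply, smul_eq_mul, Finset.mul_sum]
  refine Finset.sum_congr rfl fun i _ => Finset.sum_congr rfl fun j _ =>
    Finset.sum_congr rfl fun k _ => ?_
  ring

lemma KB_smul_right (c : ℂ) (P R : T3) : KB P (c • R) = c • KB P R := by
  ext a b
  simp only [KB, star_smul, Matrix.smul_apply, Pi.smul_apply, smul_eq_mul, Finset.mul_sum]
  refine Finset.sum_congr rfl fun i _ => Finset.sum_congr rfl fun j _ => ?_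
  ring

lemma KB_smul_left (c : ℂ) (P R : T3) : KB (c • P) R = c • KB P R := by
  ext a b
  simp only [KB, Matrix.smul_apply, Pi.smul_apply, smul_eq_mul, Finset.mul_sum]
  refine Finset.sum_congr rfl fun i _ => Finset.sum_congr rfl fun j _ => ?_
  ring

lemma Ptilde_anti {P : T3} (h : Antisym3 P) : Antisym3 (Ptilde P) := by
  have h2 : ∀ i j k, Ptilde P i j k = - Ptilde P i k j := by
    intro i j k
    simp only [Ptilde, ← Finset.sum_neg_distrib]
    exact Finset.sum_congr rfl fun d _ => by rw [h.1]; ring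
  refine ⟨fun i j k => ?_, h2⟩
  simp only [Ptilde, Kmat_eq]
  exact cubic h i j k

/-- for an antisymmetric form whose contraction with `X` is antisymmetric, the action is
three times the contraction -/
lemma act_eq (X : Matrix (Fin 6) (Fin 6) ℂ) {P R : T3} (h : Antisym3 P) (hR : Antisym3 R)
    (e : ∀ a b c, R a b c = ∑ d, P b c d * X d a) : act X P = (3 : ℂ) • R := by
  funext i j k
  have r1 : ∑ d, X d i * P d j k = R i j k := by
    rw [e]; exact Finset.sum_congr rfl fun d _ => by rw [h.1 d j k, h.2 j d k]; ring
  have r2 : ∑ d, X d j * P i d k = R i j k := by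
    rw [hR.1, e, ← Finset.sum_neg_distrib]
    exact Finset.sum_congr rfl fun d _ => by rw [h.2 i d k]; ring
  have r3 : ∑ d, X d k * P i j d = R i j k := by
    rw [hR.2, hR.1, e, neg_neg]
    exact Finset.sum_congr rfl fun d _ => by ring
  simp only [act, Finset.sum_add_distrib, r1, r2, r3, Pi.smul_apply, smul_eq_mul]
  ring

lemma mix {P : T3} (h : Antisym3 P) : KB (Ptilde P) P = Kmat P * Kmat P := by
  ext a b
  have hT := Ptilde_anti h
  rw [Kmat_eq P, Matrix.mul_apply]
  have : ∀ i j, Ptilde P b i j = ∑ d, P d i j * KB P P d b := by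
    intro i j
    simp only [Ptilde, Kmat_eq]
    exact Finset.sum_congr rfl fun d _ => by rw [h.1 d i j, h.2 i d j]; ring
  conv_lhs => unfold KB
  simp only [this]
  have e5 : ∀ (X : Matrix (Fin 6) (Fin 6) ℂ) d, KB P P a d * X d b = ∑ i, ∑ j, 1 / 2 * (star P a i j * (P d i j * X d b)) := by
    intro X d
    simp only [KB, Finset.mul_sum, Finset.sum_mul]
    refine Finset.sum_congr rfl fun i _ => Finset.sum_congr rfl fun j _ => ?_
    ring
  simp only [e5, Finset.mul_sum]
  rw [Finset.sum_comm (γ := Fin 6)]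
  symm
  rw [Finset.sum_comm]
  symm
  rw [Finset.sum_comm (γ := Fin 6)]
  exact Finset.sum_congr rfl fun i _ => Finset.sum_comm

lemma mix2 {P : T3} (h : Antisym3 P) : KB P (Ptilde P) = - (Kmat P * Kmat P) := by
  have e := equivar (Kmat P) (by rw [Kmat_eq]; exact KB_trace h) (P := P) h
  rw [act_eq (Kmat P) h (Ptilde_anti h) (fun _ _ _ => rfl), KB_smul_left, KB_smul_right, mix h,
    ← Kmat_eq, sub_self, ← smul_add] at e
  have := (smul_eq_zero.mp e).resolve_left (by norm_num)
  exact (neg_eq_of_add_eq_zero_right this).symm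

lemma Ksq {P : T3} (h : Antisym3 P) :
    Kmat P * Kmat P = Dinv P • (1 : Matrix (Fin 6) (Fin 6) ℂ) := by
  obtain ⟨c, hc⟩ := KB_sub (Ptilde_anti h) h
  rw [mix h, mix2 h, sub_neg_eq_add, ← two_smul ℂ] at hc
  have h1 : Kmat P * Kmat P = (c / 2) • (1 : Matrix (Fin 6) (Fin 6) ℂ) := by
    have := congrArg (fun M => (1/2 : ℂ) • M) hc
    simp only [smul_smul] at this
    norm_num at this
    rw [this]; congr 1; ring
  have h2 : Dinv P = c / 2 := by
    unfold Dinv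
    rw [h1, Matrix.trace_smul, Matrix.trace_one]
    simp
    ring
  rw [h2, h1]

lemma dd {P : T3} (h : Antisym3 P) (a b c : Fin 6) :
    ∑ d, Ptilde P b c d * Kmat P d a = Dinv P * P a b c := by
  have hT := Ptilde_anti h
  have e : ∀ d, Ptilde P b c d = ∑ e, P b c e * Kmat P e d := by
    intro d
    rw [hT.2, hT.1, neg_neg]; rfl
  have k := Ksq h
  calc ∑ d, Ptilde P b c d * Kmat P d a
      = ∑ e, P b c e * (Kmat P * Kmat P) e a := by
        simp only [e, Matrix.mul_apply, Finset.sum_mul, Finset.mul_sum]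
        rw [Finset.sum_comm]
        exact Finset.sum_congr rfl fun _ _ => Finset.sum_congr rfl fun _ _ => by ring
    _ = Dinv P * P b c a := by
        rw [k]
        simp [Matrix.one_apply, mul_comm]
    _ = Dinv P * P a b c := by rw [h.2 b c a, h.1 b a c, neg_neg]

lemma smul_anti (c : ℂ) {P : T3} (h : Antisym3 P) : Antisym3 (c • P) := by
  constructor <;> intro i j k <;> simp only [Pi.smul_apply, smul_eq_mul]
  · rw [h.1]; ring
  · rw [h.2]; ring

lemma Kmat_tilde {P : T3} (h : Antisym3 P) : Kmat (Ptilde P) = -(Dinv P • Kmat P) := by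
  have hT := Ptilde_anti h
  have e := equivar (Kmat P) (by rw [Kmat_eq]; exact KB_trace h) (P := Ptilde P) h
  rw [act_eq (Kmat P) h hT (fun _ _ _ => rfl),
    act_eq (Kmat P) hT (smul_anti (Dinv P) h) (fun a b c => (dd h a b c).symm),
    KB_smul_left, KB_smul_left, KB_smul_right, mix h, Ksq h, ← Kmat_eq, ← Kmat_eq, ← smul_add,
    Matrix.smul_mul, Matrix.mul_smul, one_mul, mul_one, sub_self] at e
  have := (smul_eq_zero.mp e).resolve_left (by norm_num)
  exact (neg_eq_of_add_eq_zero_right this).symm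

lemma Phat_eq (s : ℂ) (P : T3) : Phat s P = (-Complex.I / s) • Ptilde P := by
  funext i j k
  simp only [Phat, Pi.smul_apply, smul_eq_mul]
  ring

end FD

/-- for `P ∈ ∧³(ℂ^6)*` with `𝒟(P) ≠ 0` and a fixed branch `s` of
the square root of `𝒟(P)` (so `s² = 𝒟(P)`), the Freudenthal dual
`P̂ = -i P̃ / s` satisfies `𝒟(P̂) = 𝒟(P)` and `(P̂)^ = -P` (the second dual
taken with the same branch value, since `𝒟(P̂) = 𝒟(P)`). -/
theorem freudenthal_dual_properties (P : Fin 6 → Fin 6 → Fin 6 → ℂ)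
    (hP : Antisym3 P) (hD : Dinv P ≠ 0) (s : ℂ) (hs : s ^ 2 = Dinv P) :
    Dinv (Phat s P) = Dinv P ∧
    (∀ i j k, Phat s (Phat s P) i j k = -P i j k) := by
  have hc : (-Complex.I / s) * (-Complex.I / s) * Dinv P = -1 := by
    have hs0 : s ≠ 0 := by
      rintro rfl
      exact hD (by rw [← hs]; simp)
    rw [← hs]
    field_simp
    simp
  have hK : Kmat (Phat s P) = Kmat P := by
    rw [FD.Phat_eq, FD.Kmat_eq, FD.KB_smul_left, FD.KB_smul_right, ← FD.Kmat_eq,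
      FD.Kmat_tilde hP, smul_smul, smul_neg, smul_smul, hc]
    simp
  refine ⟨?_, fun i j k => ?_⟩
  · unfold Dinv
    rw [hK]
  · have e : Ptilde (Phat s P) i j k = (-Complex.I / s) * (Dinv P * P i j k) := by
      rw [← FD.dd hP, Finset.mul_sum]
      unfold Ptilde
      rw [hK, FD.Phat_eq]
      exact Finset.sum_congr rfl fun d _ => by
        simp only [Pi.smul_apply, smul_eq_mul, Ptilde]; ring
    rw [FD.Phat_eq, Pi.smul_apply, Pi.smul_apply, Pi.smul_apply, smul_eq_mul, e]
    linear_combination P i j k * hc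
end

section
/- With 𝒫 = P + ω ∧ e^7 and P ∧ ω = 0, the matrices K_P and the coefficient matrix of ω anticommute: (K_P)^c_a ω_{cb} + ω_{ac}(K_P)^c_b differs from 2(K_P)^c_a ω_{cb} only by symmetry, i.e. K_Pᵗ ω = (K_Pᵗ ω)ᵗ, equivalently ω K_P + K_Pᵗ ω = symmetric condition forcing ωK_P = -K_Pᵗω in matrix form (the matrix N_{ab} = 3(K_P)^c_a ω_{cb} is symmetric). -/
/-- Antisymmetry of the components of a two-form. -/
def Antisym2 (ω : Fin 6 → Fin 6 → ℂ) : Prop := ∀ a b, ω a b = -ω b a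

/-- The condition `P ∧ ω = 0` (primitivity of the three-form `P` with respect to
the two-form `ω`), expressed as the vanishing of the total antisymmetrization of
`P_{i_1 i_2 i_3} ω_{i_4 i_5}` in all five indices. -/
def WedgeZero (P : Fin 6 → Fin 6 → Fin 6 → ℂ) (ω : Fin 6 → Fin 6 → ℂ) : Prop :=
  ∀ f : Fin 5 → Fin 6, ∑ σ : Equiv.Perm (Fin 5),
    ((Equiv.Perm.sign σ : ℤ) : ℂ) *
      P (f (σ 0)) (f (σ 1)) (f (σ 2)) * ω (f (σ 3)) (f (σ 4)) = 0


lemma eps6_comp_swap (f : Fin 6 → Fin 6) (i j : Fin 6) (hij : i ≠ j) :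
    eps6 (fun x => f (Equiv.swap i j x)) = - eps6 f := by
  unfold eps6
  by_cases h : Function.Bijective f
  · have h' : Function.Bijective (fun x => f (Equiv.swap i j x)) :=
      h.comp (Equiv.swap i j).bijective
    rw [dif_pos h, dif_pos h']
    have e : Equiv.ofBijective _ h' = Equiv.ofBijective f h * Equiv.swap i j := by
      ext x; simp
    rw [e, Equiv.Perm.sign_mul, Equiv.Perm.sign_swap hij]
    simp
  · have h' : ¬ Function.Bijective (fun x => f (Equiv.swap i j x)) := by
      intro h'
      apply h
      have := h'.comp (Equiv.swap i j).bijective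
      convert this using 1
      ext x; simp
    rw [dif_neg h, dif_neg h']; simp

lemma sum_eps_swap (i j : Fin 6) (hij : i ≠ j) (G : (Fin 6 → Fin 6) → ℂ) :
    ∑ f, eps6 f * G (fun x => f (Equiv.swap i j x)) = - ∑ f, eps6 f * G f := by
  have := Equiv.sum_comp (Equiv.arrowCongr (Equiv.swap i j) (Equiv.refl (Fin 6)))
    (fun f : Fin 6 → Fin 6 => eps6 f * G f)
  rw [← this, ← Finset.sum_neg_distrib]
  refine Finset.sum_congr rfl fun f _ => ?_
  have e : (Equiv.arrowCongr (Equiv.swap i j) (Equiv.refl (Fin 6))) f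
      = fun x => f (Equiv.swap i j x) := by
    ext x; simp [Equiv.arrowCongr]
  rw [e, eps6_comp_swap f i j hij]; ring

lemma sum_cons {n : ℕ} (F : (Fin (n+1) → Fin 6) → ℂ) :
    ∑ f, F f = ∑ a, ∑ g : Fin n → Fin 6, F (Matrix.vecCons a g) := by
  rw [← Equiv.sum_comp (Fin.consEquiv (fun _ => Fin 6)) F, Fintype.sum_prod_type]
  rfl

lemma sum_six (F : (Fin 6 → Fin 6) → ℂ) :
    ∑ f, F f = ∑ a, ∑ b, ∑ c, ∑ d, ∑ e, ∑ g, F ![a, b, c, d, e, g] := by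
  simp only [sum_cons, Finset.univ_unique, Finset.sum_singleton]
  rfl

lemma antisym3_all {P : Fin 6 → Fin 6 → Fin 6 → ℂ} (hP : Antisym3 P) (i j k : Fin 6) :
    P i k j = - P i j k ∧ P j i k = - P i j k ∧ P j k i = P i j k ∧
    P k i j = P i j k ∧ P k j i = - P i j k := by
  obtain ⟨h1, h2⟩ := hP
  refine ⟨h2 _ _ _, h1 _ _ _, ?_, ?_, ?_⟩
  · rw [h2, h1]; ring
  · rw [h1, h2]; ring
  · rw [h1, h2, h1]; ring

lemma sum_perm_succ {n : ℕ} (F : Equiv.Perm (Fin (n+1)) → ℂ) :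
    ∑ σ, F σ = ∑ p, ∑ τ, F (Equiv.Perm.decomposeFin.symm (p, τ)) := by
  rw [← Equiv.sum_comp Equiv.Perm.decomposeFin.symm F, Fintype.sum_prod_type]

lemma wedge_ten {P : Fin 6 → Fin 6 → Fin 6 → ℂ} {ω : Fin 6 → Fin 6 → ℂ}
    (hP : Antisym3 P) (hω : Antisym2 ω) (h : WedgeZero P ω) (b i j k c : Fin 6) :
    P b i j * ω k c - P b i k * ω j c + P b i c * ω j k + P b j k * ω i c
    - P b j c * ω i k + P b k c * ω i j - P i j k * ω b c + P i j c * ω b k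
    - P i k c * ω b j + P j k c * ω b i = 0 := by
  have H := h ![b, i, j, k, c]
  have s1 : (1 : Fin 5) = Fin.succ 0 := rfl
  have s2 : (2 : Fin 5) = Fin.succ (Fin.succ 0) := rfl
  have s3 : (3 : Fin 5) = Fin.succ (Fin.succ (Fin.succ 0)) := rfl
  have s4 : (4 : Fin 5) = Fin.succ (Fin.succ (Fin.succ (Fin.succ 0))) := rfl
  simp only [sum_perm_succ, Fin.sum_univ_succ, Finset.univ_unique, Finset.sum_singleton,
    s1, s2, s3, s4, Equiv.Perm.decomposeFin_symm_apply_zero,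
    Equiv.Perm.decomposeFin_symm_apply_succ, Equiv.Perm.decomposeFin.symm_sign] at H
  have d : (default : Fin 1) = 0 := rfl
  have d' : (default : Equiv.Perm (Fin 1)) = 1 := rfl
  simp only [d, d', Equiv.Perm.sign_one, Equiv.Perm.one_apply, Equiv.swap_apply_def,
    Fin.reduceSucc, Fin.succ_zero_eq_one, Fin.reduceEq, Fin.isValue, if_true, if_false,
    mul_one, one_mul, mul_neg, neg_neg, neg_mul, Units.val_one, Units.val_neg, Int.cast_one,
    Int.cast_neg] at H
  have v0 : ![b, i, j, k, c] 0 = b := rfl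
  have v1 : ![b, i, j, k, c] 1 = i := rfl
  have v2 : ![b, i, j, k, c] 2 = j := rfl
  have v3 : ![b, i, j, k, c] 3 = k := rfl
  have v4 : ![b, i, j, k, c] 4 = c := rfl
  simp only [v0, v1, v2, v3, v4] at H
  obtain ⟨p0a, p0b, p0c, p0d, p0e⟩ := antisym3_all hP b i j
  obtain ⟨p1a, p1b, p1c, p1d, p1e⟩ := antisym3_all hP b i k
  obtain ⟨p2a, p2b, p2c, p2d, p2e⟩ := antisym3_all hP b i c
  obtain ⟨p3a, p3b, p3c, p3d, p3e⟩ := antisym3_all hP b j k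
  obtain ⟨p4a, p4b, p4c, p4d, p4e⟩ := antisym3_all hP b j c
  obtain ⟨p5a, p5b, p5c, p5d, p5e⟩ := antisym3_all hP b k c
  obtain ⟨p6a, p6b, p6c, p6d, p6e⟩ := antisym3_all hP i j k
  obtain ⟨p7a, p7b, p7c, p7d, p7e⟩ := antisym3_all hP i j c
  obtain ⟨p8a, p8b, p8c, p8d, p8e⟩ := antisym3_all hP i k c
  obtain ⟨p9a, p9b, p9c, p9d, p9e⟩ := antisym3_all hP j k c
  have w0 := hω i b
  have w1 := hω j b
  have w2 := hω k b
  have w3 := hω c b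
  have w4 := hω j i
  have w5 := hω k i
  have w6 := hω c i
  have w7 := hω k j
  have w8 := hω c j
  have w9 := hω c k
  simp only [p0a, p0b, p0c, p0d, p0e, p1a, p1b, p1c, p1d, p1e,
    p2a, p2b, p2c, p2d, p2e, p3a, p3b, p3c, p3d, p3e,
    p4a, p4b, p4c, p4d, p4e, p5a, p5b, p5c, p5d, p5e,
    p6a, p6b, p6c, p6d, p6e, p7a, p7b, p7c, p7d, p7e,
    p8a, p8b, p8c, p8d, p8e, p9a, p9b, p9c, p9d, p9e,
    w0, w1, w2, w3, w4, w5, w6, w7, w8, w9] at H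
  linear_combination H / 12

/-- `∑ ε P_a P_b ω`, the components of `ι_a P ∧ ι_b P ∧ ω`. -/
noncomputable def Vsum (P : Fin 6 → Fin 6 → Fin 6 → ℂ) (ω : Fin 6 → Fin 6 → ℂ)
    (a b : Fin 6) : ℂ :=
  ∑ f : Fin 6 → Fin 6, eps6 f * (P a (f 1) (f 2) * (P b (f 3) (f 4) * ω (f 5) (f 0)))

/-- `∑ ε P_a P ω_b`, the components of `ι_a P ∧ P ∧ ι_b ω`. -/
noncomputable def Usum (P : Fin 6 → Fin 6 → Fin 6 → ℂ) (ω : Fin 6 → Fin 6 → ℂ)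
    (a b : Fin 6) : ℂ :=
  ∑ f : Fin 6 → Fin 6, eps6 f * (P a (f 1) (f 2) * (P (f 3) (f 4) (f 5) * ω (f 0) b))

lemma Vsum_symm (P : Fin 6 → Fin 6 → Fin 6 → ℂ) (ω : Fin 6 → Fin 6 → ℂ) (a b : Fin 6) :
    Vsum P ω a b = Vsum P ω b a := by
  have q1 := sum_eps_swap 1 3 (by decide)
    (fun f => P a (f 1) (f 2) * (P b (f 3) (f 4) * ω (f 5) (f 0)))
  have q2 := sum_eps_swap 2 4 (by decide)
    (fun f => P a (f 3) (f 2) * (P b (f 1) (f 4) * ω (f 5) (f 0)))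
  simp only [Equiv.swap_apply_def, Fin.reduceEq, Fin.isValue, if_true, if_false] at q1 q2
  rw [q1, neg_neg] at q2
  unfold Vsum
  rw [← q2]
  exact Finset.sum_congr rfl fun f _ => by ring

lemma U_eq_V {P : Fin 6 → Fin 6 → Fin 6 → ℂ} {ω : Fin 6 → Fin 6 → ℂ}
    (hP : Antisym3 P) (hω : Antisym2 ω) (h : WedgeZero P ω) (a b : Fin 6) :
    4 * Usum P ω a b = - 6 * Vsum P ω a b := by
  have q0 := sum_eps_swap 4 5 (by decide)
    (fun f => P a (f 1) (f 2) * (P b (f 3) (f 4) * ω (f 5) (f 0)))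
  have q1 := sum_eps_swap 4 0 (by decide)
    (fun f => P a (f 1) (f 2) * (P b (f 3) (f 4) * ω (f 5) (f 0)))
  have q2 := sum_eps_swap 3 5 (by decide)
    (fun f => P a (f 1) (f 2) * (P b (f 3) (f 4) * ω (f 5) (f 0)))
  have q3 := sum_eps_swap 3 0 (by decide)
    (fun f => P a (f 1) (f 2) * (P b (f 3) (f 4) * ω (f 5) (f 0)))
  have q4 := sum_eps_swap 4 5 (by decide)
    (fun f => P a (f 1) (f 2) * (P b (f 0) (f 4) * ω (f 5) (f 3)))
  have q5 := sum_eps_swap 5 0 (by decide)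
    (fun f => P a (f 1) (f 2) * (P (f 3) (f 4) (f 5) * ω (f 0) b))
  have q6 := sum_eps_swap 4 0 (by decide)
    (fun f => P a (f 1) (f 2) * (P (f 3) (f 4) (f 5) * ω (f 0) b))
  have q7 := sum_eps_swap 3 0 (by decide)
    (fun f => P a (f 1) (f 2) * (P (f 3) (f 4) (f 5) * ω (f 0) b))
  simp only [Equiv.swap_apply_def, Fin.reduceEq, Fin.isValue, if_true, if_false]
    at q0 q1 q2 q3 q4 q5 q6 q7
  have key : ∑ f : Fin 6 → Fin 6, (
      eps6 f * (P a (f 1) (f 2) * (P b (f 3) (f 4) * ω (f 5) (f 0)))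
      - eps6 f * (P a (f 1) (f 2) * (P b (f 3) (f 5) * ω (f 4) (f 0)))
      - eps6 f * (P a (f 1) (f 2) * (P b (f 3) (f 0) * ω (f 5) (f 4)))
      - eps6 f * (P a (f 1) (f 2) * (P b (f 5) (f 4) * ω (f 3) (f 0)))
      - eps6 f * (P a (f 1) (f 2) * (P b (f 0) (f 4) * ω (f 5) (f 3)))
      + eps6 f * (P a (f 1) (f 2) * (P b (f 0) (f 5) * ω (f 4) (f 3)))
      + eps6 f * (P a (f 1) (f 2) * (P (f 3) (f 4) (f 5) * ω (f 0) b))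
      - eps6 f * (P a (f 1) (f 2) * (P (f 3) (f 4) (f 0) * ω (f 5) b))
      - eps6 f * (P a (f 1) (f 2) * (P (f 3) (f 0) (f 5) * ω (f 4) b))
      - eps6 f * (P a (f 1) (f 2) * (P (f 0) (f 4) (f 5) * ω (f 3) b))) = 0 := by
    refine Finset.sum_eq_zero fun f _ => ?_
    have W := wedge_ten hP hω h b (f 3) (f 4) (f 5) (f 0)
    rw [hω (f 4) (f 5), hP.2 b (f 4) (f 5), hP.2 b (f 4) (f 0), hω (f 3) (f 5),
      hP.2 b (f 5) (f 0), hω (f 3) (f 4), hω b (f 0), hω b (f 5), hω b (f 4), hω b (f 3),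
      hP.2 (f 3) (f 5) (f 0), hP.2 (f 4) (f 5) (f 0), hP.1 (f 4) (f 0) (f 5)] at W
    linear_combination (eps6 f * P a (f 1) (f 2)) * W
  simp only [Finset.sum_add_distrib, Finset.sum_sub_distrib] at key
  unfold Usum Vsum
  linear_combination key + q0 + q1 + q2 + 2 * q3 - q3 - q4 + q3 + q5 + q6 + q7

lemma KtO_apply (P : Fin 6 → Fin 6 → Fin 6 → ℂ) (ω : Fin 6 → Fin 6 → ℂ) (a b : Fin 6) :
    ((Kmat P).transpose * Matrix.of ω) a b = 1 / 12 * Usum P ω a b := by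
  unfold Usum
  rw [sum_six, Matrix.mul_apply, Finset.mul_sum]
  refine Finset.sum_congr rfl fun c _ => ?_
  simp only [Kmat, Matrix.transpose_apply, Matrix.of_apply, Finset.sum_mul, Finset.mul_sum]
  iterate 5 refine Finset.sum_congr rfl fun _ _ => ?_
  simp
  ring

/-- if `P ∧ ω = 0`, the matrix `K_Pᵗ ω` (i.e. the matrix with
entries `(K_P)^c_a ω_{cb}`, one third of `N_{ab}`) is symmetric:
`K_Pᵗ ω = (K_Pᵗ ω)ᵗ`; equivalently `ω K_P + K_Pᵗ ω = 0`, so that `ω` and `K_P`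
anticommute in this sense. -/
theorem Kmat_omega_anticommute (P : Fin 6 → Fin 6 → Fin 6 → ℂ)
    (ω : Fin 6 → Fin 6 → ℂ) (hP : Antisym3 P) (hω : Antisym2 ω)
    (hprim : WedgeZero P ω) :
    ((Kmat P).transpose * Matrix.of ω =
        ((Kmat P).transpose * Matrix.of ω).transpose) ∧
    (Matrix.of ω * Kmat P + (Kmat P).transpose * Matrix.of ω = 0) := by
  have hs : (Kmat P).transpose * Matrix.of ω =
      ((Kmat P).transpose * Matrix.of ω).transpose := by
    ext a b
    rw [Matrix.transpose_apply, KtO_apply, KtO_apply]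
    linear_combination (1 / 48 : ℂ) * U_eq_V hP hω hprim a b
      - (1 / 48 : ℂ) * U_eq_V hP hω hprim b a - (1 / 8 : ℂ) * Vsum_symm P ω a b
  refine ⟨hs, ?_⟩
  have ho : (Matrix.of ω).transpose = - Matrix.of ω := by
    ext a b
    simpa using hω b a
  rw [hs, Matrix.transpose_mul, Matrix.transpose_transpose, ho]
  rw [Matrix.neg_mul, add_neg_cancel]
end
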